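/- Let ρ be a density matrix on ℂ^N and ε ≥ 0. Then the infimum of tr(σ²) over σ ∈ B^ε(ρ) equals the infimum of tr(σ²) over σ ∈ D^ε(ρ); consequently the smooth Renyi entropy of order 2, S_2^ε(ρ) = −log₂ inf_{σ∈B^ε(ρ)} tr(σ²), can be computed by varying only the eigenvalues of ρ while keeping its eigenvectors. -/

import Mathlib

open Matrix
open scoped ComplexOrder
open Classical in
/-- The eigenvalues of a (Hermitian) matrix, listed in ascending order with
multiplicity; junk value `0` for non-Hermitian matrices. -/
noncomputable def eigAsc {N : ℕ} (A : Matrix (Fin N) (Fin N) ℂ) : Fin N → ℝ :=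
  if h : A.IsHermitian then fun i => h.eigenvalues (Tuple.sort h.eigenvalues i)
  else fun _ => 0

/-- The trace distance `‖A‖ = (1/2) ∑ᵢ |λᵢ^↑(A)|` (applied to `A = ρ - σ`). -/
noncomputable def trDist {N : ℕ} (A : Matrix (Fin N) (Fin N) ℂ) : ℝ :=
  (1 / 2) * ∑ i, |eigAsc A i|

/-- A density matrix: positive semidefinite with trace 1. -/
def IsDensity {N : ℕ} (ρ : Matrix (Fin N) (Fin N) ℂ) : Prop :=
  ρ.PosSemidef ∧ ρ.trace = 1

/-- Two real tuples with equal value multisets have the same sorted tuple. -/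
lemma sort_eq_of_multiset {N : ℕ} (f g : Fin N → ℝ)
    (h : Multiset.map f Finset.univ.val = Multiset.map g Finset.univ.val) :
    f ∘ Tuple.sort f = g ∘ Tuple.sort g := by
  apply List.ofFn_injective
  have hp : (List.ofFn (f ∘ Tuple.sort f)).Perm (List.ofFn (g ∘ Tuple.sort g)) := by
    have h1 := (Equiv.Perm.ofFn_comp_perm (Tuple.sort f) f)
    have h2 := (Equiv.Perm.ofFn_comp_perm (Tuple.sort g) g)
    refine h1.trans (List.Perm.trans ?_ h2.symm)
    rw [Fin.univ_val_map, Fin.univ_val_map] at h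
    exact Multiset.coe_eq_coe.mp h
  refine hp.eq_of_pairwise (le := (· ≤ ·)) ?_ ?_ ?_
  · intro a b _ _ h1 h2
    exact le_antisymm h1 h2
  · exact List.sortedLE_iff_pairwise.mp (Tuple.monotone_sort f).sortedLE_ofFn
  · exact List.sortedLE_iff_pairwise.mp (Tuple.monotone_sort g).sortedLE_ofFn

/-- Sorting is monotone. -/
lemma sort_mono {N : ℕ} (x y : Fin N → ℝ) (h : ∀ i, x i ≤ y i) (k : Fin N) :
    x (Tuple.sort x k) ≤ y (Tuple.sort y k) := by
  have hx := Tuple.monotone_sort x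
  have hy := Tuple.monotone_sort y
  obtain ⟨j, hj, hjk⟩ : ∃ j, j ≤ k ∧ k ≤ (Tuple.sort x).symm (Tuple.sort y j) := by
    by_contra! hcon
    have hc : (Finset.Iic k).card ≤ (Finset.Iio k).card := by
      refine Finset.card_le_card_of_injOn (fun j => (Tuple.sort x).symm (Tuple.sort y j)) ?_ ?_
      · intro j hj
        simpa using hcon j (by simpa using hj)
      · intro a _ b _ hab
        simpa using hab
    simp at hc
  have h1 := hx hjk
  have h2 := hy hj
  simp only [Function.comp_apply, Equiv.apply_symm_apply] at h1 h2
  exact h1.trans ((h _).trans h2)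

lemma sum_sort {N : ℕ} (x : Fin N → ℝ) : ∑ i, x (Tuple.sort x i) = ∑ i, x i :=
  Equiv.sum_comp (Tuple.sort x) x

/-- Sorting is an `ℓ¹` contraction. -/
lemma sort_l1 {N : ℕ} (r s : Fin N → ℝ) :
    ∑ i, |r (Tuple.sort r i) - s (Tuple.sort s i)| ≤ ∑ i, |r i - s i| := by
  set c : Fin N → ℝ := fun i => max (r i) (s i) with hc
  have h1 : ∀ i, |r (Tuple.sort r i) - s (Tuple.sort s i)| ≤
      2 * c (Tuple.sort c i) - r (Tuple.sort r i) - s (Tuple.sort s i) := by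
    intro i
    have ha := sort_mono r c (fun i => le_max_left _ _) i
    have hb := sort_mono s c (fun i => le_max_right _ _) i
    rw [abs_le]
    constructor <;> linarith
  refine (Finset.sum_le_sum fun i _ => h1 i).trans (le_of_eq ?_)
  rw [Finset.sum_sub_distrib, Finset.sum_sub_distrib, ← Finset.mul_sum, sum_sort, sum_sort,
    sum_sort, Finset.mul_sum, ← Finset.sum_sub_distrib, ← Finset.sum_sub_distrib]
  refine Finset.sum_congr rfl fun i _ => ?_
  rcases le_total (r i) (s i) with h | h
  · simp only [hc, max_eq_right h]
    rw [abs_of_nonpos (by linarith)]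
    ring
  · simp only [hc, max_eq_left h]
    rw [abs_of_nonneg (by linarith)]
    ring

/-- `U diag(d) U*`. -/
noncomputable def cj {N : ℕ} (U : Matrix (Fin N) (Fin N) ℂ) (d : Fin N → ℝ) :
    Matrix (Fin N) (Fin N) ℂ :=
  U * diagonal (fun i => (d i : ℂ)) * Uᴴ

lemma cj_herm {N : ℕ} (U : Matrix (Fin N) (Fin N) ℂ) (d : Fin N → ℝ) :
    (cj U d).IsHermitian := by
  apply isHermitian_mul_mul_conjTranspose
  rw [isHermitian_diagonal_iff]
  intro i
  simp [IsSelfAdjoint]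

lemma cj_mul {N : ℕ} (U : Matrix (Fin N) (Fin N) ℂ) (hU : Uᴴ * U = 1) (d e : Fin N → ℝ) :
    cj U d * cj U e = cj U (fun i => d i * e i) := by
  unfold cj
  calc _ = U * diagonal (fun i => (d i : ℂ)) * (Uᴴ * U) * diagonal (fun i => (e i : ℂ)) * Uᴴ := by
        simp only [Matrix.mul_assoc]
    _ = _ := by
        rw [hU, Matrix.mul_one, Matrix.mul_assoc U, diagonal_mul_diagonal]
        simp

lemma cj_sub {N : ℕ} (U : Matrix (Fin N) (Fin N) ℂ) (d e : Fin N → ℝ) :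
    cj U d - cj U e = cj U (fun i => d i - e i) := by
  unfold cj
  rw [← Matrix.sub_mul, ← Matrix.mul_sub, diagonal_sub]
  simp

lemma cj_trace {N : ℕ} (U : Matrix (Fin N) (Fin N) ℂ) (hU : Uᴴ * U = 1) (d : Fin N → ℝ) :
    (cj U d).trace = ((∑ i, d i : ℝ) : ℂ) := by
  unfold cj
  rw [Matrix.trace_mul_comm, ← Matrix.mul_assoc, hU, Matrix.one_mul, trace_diagonal]
  simp

lemma cj_eigAsc {N : ℕ} (U : Matrix (Fin N) (Fin N) ℂ) (hU : Uᴴ * U = 1) (d : Fin N → ℝ) :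
    eigAsc (cj U d) = d ∘ Tuple.sort d := by
  have hh := cj_herm U d
  unfold eigAsc
  rw [dif_pos hh]
  change hh.eigenvalues ∘ Tuple.sort hh.eigenvalues = _
  apply sort_eq_of_multiset
  have h1 := hh.roots_charpoly_eq_eigenvalues
  have h2 : (cj U d).charpoly.roots = Multiset.map (fun i => (d i : ℂ)) Finset.univ.val := by
    unfold cj
    rw [charpoly_mul_comm, ← Matrix.mul_assoc, hU, Matrix.one_mul, charpoly_diagonal,
      Polynomial.roots_prod]
    · simp
    · simp [Finset.prod_ne_zero_iff, Polynomial.X_sub_C_ne_zero]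
  rw [h2] at h1
  have h3 := congrArg (Multiset.map Complex.re) h1
  simp only [Multiset.map_map] at h3
  symm
  simpa [Function.comp_def] using h3

lemma exists_cj {N : ℕ} (A : Matrix (Fin N) (Fin N) ℂ) (hA : A.IsHermitian) :
    ∃ (U : Matrix (Fin N) (Fin N) ℂ) (d : Fin N → ℝ), Uᴴ * U = 1 ∧ A = cj U d := by
  refine ⟨hA.eigenvectorUnitary, hA.eigenvalues, ?_, ?_⟩
  · exact Unitary.coe_star_mul_self hA.eigenvectorUnitary
  · have := hA.spectral_theorem
    rw [Unitary.conjStarAlgAut_apply] at this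
    exact this

lemma cj_trDist {N : ℕ} (U : Matrix (Fin N) (Fin N) ℂ) (hU : Uᴴ * U = 1) (d : Fin N → ℝ) :
    trDist (cj U d) = (1 / 2) * ∑ i, |d i| := by
  unfold trDist
  rw [cj_eigAsc U hU]
  congr 1
  exact Equiv.sum_comp (Tuple.sort d) (fun i => |d i|)

lemma cj_posSemidef {N : ℕ} (U : Matrix (Fin N) (Fin N) ℂ) (d : Fin N → ℝ) (hd : ∀ i, 0 ≤ d i) :
    (cj U d).PosSemidef := by
  apply PosSemidef.mul_mul_conjTranspose_same
  rw [posSemidef_diagonal_iff]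
  intro i
  exact_mod_cast hd i

lemma cj_nonneg {N : ℕ} (U : Matrix (Fin N) (Fin N) ℂ) (hU : Uᴴ * U = 1) (d : Fin N → ℝ)
    (h : (cj U d).PosSemidef) (i : Fin N) : 0 ≤ d i := by
  have h1 := (h.conjTranspose_mul_mul_same U).diag_nonneg (i := i)
  have h2 : Uᴴ * cj U d * U = diagonal (fun i => (d i : ℂ)) := by
    unfold cj
    calc _ = (Uᴴ * U) * diagonal (fun i => (d i : ℂ)) * (Uᴴ * U) := by
          simp only [Matrix.mul_assoc]
      _ = _ := by rw [hU]; simp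
  rw [h2] at h1
  simpa using h1

/-- Diagonal entries of `W diag(d) W*`. -/
lemma cj_diag {N : ℕ} (W : Matrix (Fin N) (Fin N) ℂ) (d : Fin N → ℝ) (i : Fin N) :
    ((cj W d) i i).re = ∑ j, ‖W i j‖ ^ 2 * d j := by
  unfold cj
  rw [Matrix.mul_apply, Complex.re_sum]
  refine Finset.sum_congr rfl fun j _ => ?_
  rw [mul_diagonal, conjTranspose_apply]
  have : W i j * (d j : ℂ) * star (W i j) = ((‖W i j‖ ^ 2 * d j : ℝ) : ℂ) := by
    have h := Complex.mul_conj' (W i j)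
    push_cast
    rw [← h]
    simp only [RCLike.star_def]
    ring
  rw [this, Complex.ofReal_re]

lemma pinch_l1 {N : ℕ} (W : Matrix (Fin N) (Fin N) ℂ) (hW : Wᴴ * W = 1) (d : Fin N → ℝ) :
    ∑ i, |((cj W d) i i).re| ≤ ∑ i, |d i| := by
  have hcol : ∀ j, ∑ i, ‖W i j‖ ^ 2 = 1 := by
    intro j
    have h := congrFun (congrFun hW j) j
    rw [Matrix.mul_apply, Matrix.one_apply_eq] at h
    have h2 : ((∑ i, ‖W i j‖ ^ 2 : ℝ) : ℂ) = 1 := by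
      rw [← h]
      push_cast
      refine Finset.sum_congr rfl fun i _ => ?_
      rw [conjTranspose_apply, RCLike.star_def, Complex.conj_mul']
    exact_mod_cast h2
  calc ∑ i, |((cj W d) i i).re| ≤ ∑ i, ∑ j, ‖W i j‖ ^ 2 * |d j| := by
        refine Finset.sum_le_sum fun i _ => ?_
        rw [cj_diag]
        refine (Finset.abs_sum_le_sum_abs _ _).trans (le_of_eq ?_)
        refine Finset.sum_congr rfl fun j _ => ?_
        rw [abs_mul, abs_of_nonneg (by positivity)]
    _ = ∑ j, |d j| := by
        rw [Finset.sum_comm]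
        refine Finset.sum_congr rfl fun j _ => ?_
        rw [← Finset.sum_mul, hcol, one_mul]

lemma herm_tr_sq {N : ℕ} (M : Matrix (Fin N) (Fin N) ℂ) (hM : M.IsHermitian) :
    ∑ i, (M i i).re * (M i i).re ≤ (M * M).trace.re := by
  have h : (M * M).trace.re = ∑ i, ∑ j, ‖M i j‖ ^ 2 := by
    simp only [Matrix.trace, diag_apply, Matrix.mul_apply, Complex.re_sum]
    refine Finset.sum_congr rfl fun i _ => Finset.sum_congr rfl fun j _ => ?_
    rw [← hM.apply j i, RCLike.star_def, Complex.mul_conj']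
    norm_cast
  rw [h]
  refine Finset.sum_le_sum fun i _ => ?_
  refine le_trans ?_ (Finset.single_le_sum (f := fun j => ‖M i j‖ ^ 2)
    (fun j _ => by positivity) (Finset.mem_univ i))
  have := Complex.abs_re_le_norm (M i i)
  rw [← abs_mul_abs_self (M i i).re]
  nlinarith [abs_nonneg (M i i).re]

lemma ball_to_comm {N : ℕ} (ρ σ : Matrix (Fin N) (Fin N) ℂ) (hρ : IsDensity ρ)
    (hσ : IsDensity σ) :
    ∃ τ, IsDensity τ ∧ τ * ρ = ρ * τ ∧
      (1 / 2) * ∑ i, |eigAsc ρ i - eigAsc τ i| ≤ trDist (ρ - σ) ∧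
      (τ * τ).trace.re ≤ (σ * σ).trace.re := by
  obtain ⟨U, r, hU, rfl⟩ := exists_cj ρ hρ.1.1
  have hU' : U * Uᴴ = 1 := mul_eq_one_comm.mp hU
  have hM : (Uᴴ * σ * U).PosSemidef := hσ.1.conjTranspose_mul_mul_same U
  set M := Uᴴ * σ * U with hMdef
  have htr : ∀ X : Matrix (Fin N) (Fin N) ℂ, (Uᴴ * X * U).trace = X.trace := by
    intro X
    rw [Matrix.trace_mul_comm, ← Matrix.mul_assoc, hU', Matrix.one_mul]
  refine ⟨cj U (fun i => (M i i).re), ⟨cj_posSemidef _ _ ?_, ?_⟩, ?_, ?_, ?_⟩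
  · intro i
    exact (Complex.nonneg_iff.mp (hM.diag_nonneg (i := i))).1
  · rw [cj_trace U hU]
    have h1 : M.trace = 1 := by rw [hMdef, htr, hσ.2]
    have h2 := congrArg Complex.re h1
    simp only [Matrix.trace, diag_apply, Complex.re_sum, Complex.one_re] at h2
    rw [h2, Complex.ofReal_one]
  · rw [cj_mul U hU, cj_mul U hU]
    simp only [mul_comm]
  · rw [cj_eigAsc U hU, cj_eigAsc U hU]
    obtain ⟨V, d, hV, hd⟩ := exists_cj (cj U r - σ) ((cj_herm U r).sub hσ.1.1)
    rw [hd, cj_trDist V hV]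
    have hW : (Uᴴ * V)ᴴ * (Uᴴ * V) = 1 := by
      rw [conjTranspose_mul, conjTranspose_conjTranspose]
      calc _ = Vᴴ * (U * Uᴴ) * V := by simp only [Matrix.mul_assoc]
        _ = 1 := by rw [hU', Matrix.mul_one, hV]
    have h1 := pinch_l1 (Uᴴ * V) hW d
    have h2 : cj (Uᴴ * V) d = diagonal (fun i => (r i : ℂ)) - M := by
      have e1 : cj (Uᴴ * V) d = Uᴴ * cj V d * U := by
        unfold cj
        rw [conjTranspose_mul, conjTranspose_conjTranspose]
        simp only [Matrix.mul_assoc]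
      have e2 : Uᴴ * cj U r * U = diagonal (fun i => (r i : ℂ)) := by
        unfold cj
        calc _ = (Uᴴ * U) * diagonal (fun i => (r i : ℂ)) * (Uᴴ * U) := by
              simp only [Matrix.mul_assoc]
          _ = _ := by rw [hU]; simp
      rw [e1, ← hd, Matrix.mul_sub, Matrix.sub_mul, e2]
    have h3 := sort_l1 r (fun i => (M i i).re)
    rw [h2] at h1
    simp only [Matrix.sub_apply, diagonal_apply_eq, Complex.sub_re, Complex.ofReal_re] at h1
    exact mul_le_mul_of_nonneg_left (h3.trans h1) (by norm_num)
  · rw [cj_mul U hU, cj_trace U hU, Complex.ofReal_re]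
    refine (herm_tr_sq M hM.1).trans (le_of_eq ?_)
    have : M * M = Uᴴ * (σ * σ) * U := by
      calc M * M = Uᴴ * σ * (U * Uᴴ) * σ * U := by
            rw [hMdef]
            simp only [Matrix.mul_assoc]
        _ = _ := by
            rw [hU', Matrix.mul_one]
            simp only [Matrix.mul_assoc]
    rw [this, htr]

lemma comm_to_ball {N : ℕ} (ρ σ : Matrix (Fin N) (Fin N) ℂ) (hρ : IsDensity ρ)
    (hσ : IsDensity σ) :
    ∃ τ, IsDensity τ ∧
      trDist (ρ - τ) = (1 / 2) * ∑ i, |eigAsc ρ i - eigAsc σ i| ∧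
      (τ * τ).trace.re = (σ * σ).trace.re := by
  obtain ⟨U, r, hU, rfl⟩ := exists_cj ρ hρ.1.1
  obtain ⟨V, s, hV, rfl⟩ := exists_cj σ hσ.1.1
  set e : Equiv.Perm (Fin N) := (Tuple.sort r).symm.trans (Tuple.sort s) with he
  refine ⟨cj U (fun i => s (e i)), ⟨cj_posSemidef _ _ ?_, ?_⟩, ?_, ?_⟩
  · intro i
    exact cj_nonneg V hV s hσ.1 _
  · rw [cj_trace U hU, Equiv.sum_comp e s, ← cj_trace V hV, hσ.2]
  · rw [cj_sub, cj_trDist U hU, cj_eigAsc U hU, cj_eigAsc V hV]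
    congr 1
    rw [← Equiv.sum_comp (Tuple.sort r)]
    simp [he]
  · rw [cj_mul U hU, cj_mul V hV, cj_trace U hU, cj_trace V hV,
      Equiv.sum_comp e (fun i => s i * s i)]

lemma trace_sq_nonneg {N : ℕ} (σ : Matrix (Fin N) (Fin N) ℂ) (hσ : IsDensity σ) :
    0 ≤ (σ * σ).trace.re :=
  le_trans (Finset.sum_nonneg fun _ _ => mul_self_nonneg _) (herm_tr_sq σ hσ.1.1)

/-- The infimum of tr(σ²) over the trace-distance ε-ball `B^ε(ρ)`
of density matrices equals the infimum of tr(σ²) over the set `D^ε(ρ)` of density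
matrices commuting with ρ whose ordered spectrum is ε-close to that of ρ. -/
theorem stmt3 {N : ℕ} (ρ : Matrix (Fin N) (Fin N) ℂ) (hρ : IsDensity ρ)
    (ε : ℝ) (hε : 0 ≤ ε) :
    sInf {t : ℝ | ∃ σ, IsDensity σ ∧ trDist (ρ - σ) ≤ ε ∧ (Matrix.trace (σ * σ)).re = t} =
    sInf {t : ℝ | ∃ σ, IsDensity σ ∧ σ * ρ = ρ * σ ∧
      (1 / 2) * ∑ i, |eigAsc ρ i - eigAsc σ i| ≤ ε ∧ (Matrix.trace (σ * σ)).re = t} := by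
  have h0 : (1 / 2 : ℝ) * ∑ i, |eigAsc ρ i - eigAsc ρ i| ≤ ε := by simpa using hε
  apply le_antisymm
  · refine le_csInf ⟨_, ρ, hρ, rfl, h0, rfl⟩ ?_
    rintro t ⟨σ, hσ, -, hd, rfl⟩
    obtain ⟨τ, hτ, h1, h2⟩ := comm_to_ball ρ σ hρ hσ
    refine csInf_le ⟨0, ?_⟩ ⟨τ, hτ, h1.le.trans hd, h2⟩
    rintro t ⟨x, hx, -, rfl⟩
    exact trace_sq_nonneg x hx
  · obtain ⟨τ₀, hτ₀, h1₀, -⟩ := comm_to_ball ρ ρ hρ hρ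
    refine le_csInf ⟨_, τ₀, hτ₀, h1₀.le.trans h0, rfl⟩ ?_
    rintro t ⟨σ, hσ, hd, rfl⟩
    obtain ⟨τ, hτ, hc, h1, h2⟩ := ball_to_comm ρ σ hρ hσ
    refine le_trans (csInf_le ⟨0, ?_⟩ ⟨τ, hτ, hc, h1.trans hd, rfl⟩) h2
    rintro t ⟨x, hx, -, -, rfl⟩
    exact trace_sq_nonneg x hx
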